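/- There exists a countably infinite acyclic oriented graph D such that: (a) every finite acyclic oriented graph embeds into D, and every countably infinite acyclic oriented graph of order type ω embeds into D; and (b) every finite acyclic oriented graph A has finite big Ramsey degree in D, i.e., there exists a positive integer T such that for every k ≥ 2 and every coloring χ of the set of embeddings of A into D with k colors there is an embedding w of D into itself such that {χ(w ∘ f) : f an embedding of A into D} has at most T elements. -/

import Mathlib

/-- An oriented graph: an irreflexive binary relation `r` with
`r x y → ¬ r y x`. -/
def IsOrientedGraph {A : Type} (r : A → A → Prop) : Prop :=
  (∀ x, ¬ r x x) ∧ ∀ x y, r x y → ¬ r y x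

/-- Acyclic: no directed cycle, i.e. the transitive closure is irreflexive. -/
def IsAcyclic {A : Type} (r : A → A → Prop) : Prop :=
  ∀ x, ¬ Relation.TransGen r x x

/-- There is a linear order of order type `ω` on the vertices extending `r`. -/
def AcyclicOfOrderTypeOmega {A : Type} (r : A → A → Prop) : Prop :=
  ∃ e : A ≃ ℕ, ∀ x y, r x y → e x < e y

/-- An embedding of oriented graphs: an injective map preserving and
reflecting the arrow relation. -/
def OEmb {A B : Type} (rA : A → A → Prop) (rB : B → B → Prop) (f : A → B) : Prop :=
  Function.Injective f ∧ ∀ x y, rA x y ↔ rB (f x) (f y)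

open Filter
attribute [local instance] Ultrafilter.mul Ultrafilter.semigroup

theorem exists_min_idem {M : Type} [Semigroup M] [TopologicalSpace M] [CompactSpace M] [T2Space M]
    (hc : ∀ r : M, Continuous (· * r)) (x : M) :
    ∃ e : M, e * e = e ∧ (∃ y, e = y * x) ∧ ∀ z, ∃ t, t * (z * e) = e := by
  let S : Set (Set M) :=
    { N | IsClosed N ∧ N.Nonempty ∧ (∀ m, ∀ n ∈ N, m * n ∈ N) ∧ N ⊆ Set.range (· * x) }
  have hcl : ∀ r : M, IsClosed (Set.range (· * r)) := fun r =>
    (isCompact_range (hc r)).isClosed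
  obtain ⟨N, hN⟩ : ∃ N', Minimal (· ∈ S) N' := by
    have hx : Set.range (· * x) ∈ S := by
      refine ⟨hcl x, ⟨x * x, x, rfl⟩, ?_, subset_rfl⟩
      rintro m _ ⟨n, rfl⟩
      exact ⟨m * n, mul_assoc _ _ _⟩
    obtain ⟨N, _, hN⟩ := zorn_superset_nonempty S (by
      intro c hcs hch hne
      refine ⟨⋂₀ c, ⟨isClosed_sInter fun t ht => (hcs ht).1, ?_, ?_, ?_⟩,
        fun s hs => Set.sInter_subset_of_mem hs⟩
      · rw [Set.sInter_eq_iInter]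
        have := hne.coe_sort
        exact IsCompact.nonempty_iInter_of_directed_nonempty_isCompact_isClosed
          ((↑) : c → Set M) (DirectedOn.directed_val (IsChain.directedOn hch.symm))
          (fun i => (hcs i.prop).2.1) (fun i => (hcs i.prop).1.isCompact)
          (fun i => (hcs i.prop).1)
      · intro m n hn t ht
        exact (hcs ht).2.2.1 m n (hn t ht)
      · obtain ⟨t, ht⟩ := hne
        exact (Set.sInter_subset_of_mem ht).trans (hcs ht).2.2.2) _ hx
    exact ⟨N, hN⟩
  obtain ⟨Ncl, Nne, Nmul, Nsub⟩ := hN.prop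
  obtain ⟨e, heN, he⟩ := exists_idempotent_in_compact_subsemigroup hc N Nne Ncl.isCompact
    (fun m _ n hn => Nmul m n hn)
  refine ⟨e, he, ?_, ?_⟩
  · obtain ⟨y, hy⟩ := Nsub heN
    exact ⟨y, hy.symm⟩
  · intro z
    have hsub : Set.range (· * (z * e)) ⊆ N := by
      rintro _ ⟨t, rfl⟩
      exact Nmul _ _ (Nmul _ _ heN)
    have hmem : Set.range (· * (z * e)) ∈ S := by
      refine ⟨hcl _, ⟨_, z, rfl⟩, ?_, hsub.trans Nsub⟩
      rintro m _ ⟨n, rfl⟩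
      exact ⟨m * n, mul_assoc _ _ _⟩
    have := hN.eq_of_subset hmem hsub
    rw [← this] at heN
    exact heN

theorem exists_absorb {C P Q : Type} [Semigroup P] [TopologicalSpace P] [CompactSpace P]
    [T2Space P] [Semigroup Q] [TopologicalSpace Q] [CompactSpace Q] [T2Space Q]
    (hP : ∀ r : P, Continuous (· * r)) (hQ : ∀ r : Q, Continuous (· * r)) [Nonempty P]
    (φ : C → Q → P) (hφ : ∀ a x y, φ a (x * y) = φ a x * φ a y)
    (i : P → Q) (hi : ∀ x y, i (x * y) = i x * i y) (hφi : ∀ a x, φ a (i x) = x) (v : Q) :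
    ∃ (p : P) (h : Q), p * p = p ∧ ∀ a, p * (φ a v * φ a h) = p := by
  obtain ⟨p, hp, -, hpm⟩ := exists_min_idem hP (Classical.arbitrary P)
  obtain ⟨e, he, ⟨y, hy⟩, hem⟩ := exists_min_idem hQ (i p)
  have hep : e * i p = e := by rw [hy, mul_assoc, ← hi, hp]
  have hpp : i p * i p = i p := by rw [← hi, hp]
  obtain ⟨q, hq⟩ : ∃ q, q = i p * e := ⟨_, rfl⟩
  have hqq : q * q = q := by
    rw [hq, mul_assoc, ← mul_assoc e, hep, he]
  have hqp : q * i p = q := by rw [hq, mul_assoc, hep]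
  have hpq : i p * q = q := by rw [hq, ← mul_assoc, hpp]
  have hqm : ∀ z, ∃ t, t * (z * q) = q := by
    intro z
    obtain ⟨t, ht⟩ := hem (z * i p)
    refine ⟨i p * t, ?_⟩
    rw [mul_assoc, hq, ← mul_assoc z, ht]
  -- left inverses in q Q q
  have hinv : ∀ g, q * g = g → g * q = g → ∃ t, q * t = t ∧ t * q = t ∧ t * g = q := by
    intro g h1 h2
    obtain ⟨t, ht⟩ := hqm g
    rw [h2] at ht
    refine ⟨q * t * q, ?_, ?_, ?_⟩
    · rw [mul_assoc, ← mul_assoc, hqq]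
    · rw [mul_assoc, hqq]
    · rw [mul_assoc, h1, mul_assoc, ht, hqq]
  obtain ⟨t, ht1, ht2, ht3⟩ := hinv (q * v * q) (by simp only [← mul_assoc, hqq])
    (by rw [mul_assoc, hqq])
  obtain ⟨s, hs1, hs2, hs3⟩ := hinv t ht1 ht2
  have hsg : s = q * v * q := by
    have : s * (t * (q * v * q)) = s := by rw [ht3, hs2]
    rw [← mul_assoc, hs3] at this
    rw [← this]
    simp only [← mul_assoc, hqq]
  have hφq : ∀ a, φ a q = p := by
    intro a
    have h1 : φ a q * φ a q = φ a q := by rw [← hφ, hqq]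
    have h3 : p * φ a q = φ a q := by
      have := congrArg (φ a) hpq
      rwa [hφ, hφi] at this
    have h2 : φ a q * p = φ a q := by
      have := congrArg (φ a) hqp
      rwa [hφ, hφi] at this
    obtain ⟨t, ht⟩ := hpm (φ a q)
    rw [h2] at ht
    have : p * φ a q = p := by
      rw [← ht, mul_assoc, h1]
    rw [← h3, this]
  refine ⟨p, q * t, hp, fun a => ?_⟩
  have : q * v * (q * t) = q := by
    rw [← mul_assoc, ← hsg, hs3]
  have := congrArg (φ a) this
  rw [hφ, hφ, hφq, mul_assoc] at this
  exact this

theorem map_ultra_mul {M N : Type} [Semigroup M] [Semigroup N] (f : M → N)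
    (hf : ∀ x y, f (x * y) = f x * f y) (U V : Ultrafilter M) :
    (U * V).map f = U.map f * V.map f := by
  apply Ultrafilter.coe_inj.mp
  apply Filter.ext'
  intro p
  rw [Ultrafilter.eventually_mul]
  simp only [Ultrafilter.coe_map, Filter.eventually_map]
  rw [Ultrafilter.eventually_mul]
  simp only [hf]

/-- Evaluate the variable `none` of a variable word at `a`. -/
def evw {C : Type} (a : C) : FreeMonoid (Option C) →* FreeMonoid C :=
  FreeMonoid.map (fun o => o.getD a)

theorem exists_large {C K : Type} [Finite C] [Finite K] (χ : FreeMonoid C → K) :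
    ∃ (k : K) (L : FreeMonoid C → Prop), (∃ s, L s) ∧ (∀ s, L s → χ s = k) ∧
      ∀ F : Set (FreeMonoid C), F.Finite → (∀ s ∈ F, L s) →
        ∃ y : FreeMonoid (Option C), ∀ s ∈ F, ∀ a, L (s * (FreeMonoid.of a * evw a y)) := by
  obtain ⟨p, h, hp, hph⟩ := exists_absorb (C := C) (P := Ultrafilter (FreeMonoid C))
    (Q := Ultrafilter (FreeMonoid (Option C))) Ultrafilter.continuous_mul_left
    Ultrafilter.continuous_mul_left (fun a U => U.map (evw a))
    (fun a => map_ultra_mul _ (map_mul _)) (fun U => U.map (FreeMonoid.map some))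
    (map_ultra_mul _ (map_mul _))
    (by
      intro a U
      rw [Ultrafilter.map_map]
      have : (evw a : FreeMonoid (Option C) → FreeMonoid C) ∘ (FreeMonoid.map some) = id := by
        funext s
        simp only [evw, Function.comp, FreeMonoid.map_map]
        exact List.map_id _
      rw [this, Ultrafilter.map_id])
    (pure (FreeMonoid.of none))
  obtain ⟨V, hV⟩ : ∃ V, V = h * p.map (FreeMonoid.map some) := ⟨_, rfl⟩
  obtain ⟨e, he⟩ : ∃ e : C → Ultrafilter (FreeMonoid C),
    e = fun a => ((pure (FreeMonoid.of none) : Ultrafilter (FreeMonoid (Option C)))).map (evw a)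
      * (h.map (evw a)) * p := ⟨_, rfl⟩
  have heq : ∀ a, ∀ Q : FreeMonoid C → Prop,
      (∀ᶠ t in e a, Q t) ↔ ∀ᶠ y in V, Q (FreeMonoid.of a * evw a y) := by
    intro a Q
    rw [he, hV]
    simp only [Ultrafilter.eventually_mul, Ultrafilter.map_pure]
    simp only [Ultrafilter.coe_map, Ultrafilter.coe_pure, Filter.eventually_pure,
      Filter.eventually_map]
    have : ∀ s : FreeMonoid C, evw a (FreeMonoid.map some s) = s := by
      intro s
      simp only [evw, FreeMonoid.map_map]
      exact List.map_id _
    have h2 : evw a (FreeMonoid.of none) = FreeMonoid.of a := rfl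
    simp only [map_mul, this, h2, mul_assoc]
  have hpe : ∀ a, p * e a = p := by
    intro a
    rw [he]
    simp only
    rw [← mul_assoc, hph, hp]
  have hee : ∀ a b, e a * e b = e a := by
    intro a b
    have hea := congrFun he a
    rw [hea, mul_assoc, hpe]
  obtain ⟨k, hk⟩ : ∃ k, ∀ᶠ s in p, χ s = k := by
    obtain ⟨k, hk⟩ := Ultrafilter.eq_pure_of_finite (p.map χ)
    refine ⟨k, ?_⟩
    have : ∀ᶠ x in (p.map χ), x = k := by rw [hk]; simp
    simpa using this
  let L : FreeMonoid C → Prop := fun s => χ s = k ∧ ∀ a, ∀ᶠ t in e a, χ (s * t) = k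
  have hLstep : ∀ s, L s → ∀ a, ∀ᶠ t in e a, L (s * t) := by
    intro s hs a
    refine (hs.2 a).and (Filter.eventually_all.2 fun b => ?_)
    have := hs.2 a
    rw [← hee a b, Ultrafilter.eventually_mul] at this
    simpa only [mul_assoc] using this
  refine ⟨k, L, ?_, fun s hs => hs.1, ?_⟩
  · have : ∀ᶠ s in p, L s := by
      refine hk.and (Filter.eventually_all.2 fun b => ?_)
      have := hk
      rw [← hpe b, Ultrafilter.eventually_mul] at this
      exact this
    exact this.exists
  · intro F hF hFL
    have : ∀ᶠ y in V, ∀ s ∈ F, ∀ a, L (s * (FreeMonoid.of a * evw a y)) := by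
      rw [Filter.eventually_all_finite hF]
      intro s hs
      refine Filter.eventually_all.2 fun a => ?_
      exact (heq a (fun t => L (s * t))).1 (hLstep s (hFL s hs) a)
    exact this.exists

/-! ### Natural substitutions -/

/-- A substitution with constants in `C`, acting naturally on words over all alphabets. -/
structure NSub (C : Type) where
  fn : ∀ {X : Type}, (C → X) → List X → List X
  nat : ∀ {X Y : Type} (f : X → Y) (c : C → X) (u : List X),
    fn (f ∘ c) (u.map f) = (fn c u).map f
  ext : ∀ {X : Type} (c : C → X) (u : List X) (b : X), ∃ s, fn c (u ++ [b]) = fn c u ++ b :: s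

namespace NSub
variable {C X : Type}

theorem ext' (g : NSub C) (c : C → X) (u : List X) (b : X) (t : List X) :
    ∃ s, g.fn c (u ++ b :: t) = g.fn c u ++ b :: s := by
  induction t using List.reverseRecOn with
  | nil => exact g.ext c u b
  | append_singleton t d ih =>
    obtain ⟨s, hs⟩ := ih
    obtain ⟨s', hs'⟩ := g.ext c (u ++ b :: t) d
    refine ⟨s ++ d :: s', ?_⟩
    have : u ++ b :: (t ++ [d]) = (u ++ b :: t) ++ [d] := by simp
    rw [this, hs', hs]
    simp

/-- The identity substitution. -/
def one (C : Type) : NSub C where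
  fn _ u := u
  nat _ _ _ := rfl
  ext _ _ _ := ⟨[], rfl⟩

/-- Composition of substitutions. -/
def comp (g h : NSub C) : NSub C where
  fn c u := g.fn c (h.fn c u)
  nat f c u := by rw [h.nat, g.nat]
  ext c u b := by
    obtain ⟨s, hs⟩ := h.ext c u b
    rw [hs]
    exact g.ext' c _ b s

theorem supp (g : NSub C) (c : C → X) (u : List X) :
    ∀ x ∈ g.fn c u, x ∈ Set.range c ∨ x ∈ u := by
  let Y := {x : X // x ∈ Set.range c ∨ x ∈ u}
  let c' : C → Y := fun a => ⟨c a, Or.inl ⟨a, rfl⟩⟩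
  let u' : List Y := u.attach.map fun x => ⟨x.1, Or.inr x.2⟩
  have hu : u'.map Subtype.val = u := by
    simp only [u', List.map_map]
    exact List.attach_map_subtype_val u
  have := g.nat (Subtype.val : Y → X) c' u'
  rw [hu] at this
  have hc : (Subtype.val : Y → X) ∘ c' = c := rfl
  rw [hc] at this
  intro x hx
  rw [this] at hx
  obtain ⟨y, _, rfl⟩ := List.mem_map.1 hx
  exact y.2

theorem mem_fn (g : NSub C) (c : C → X) (u : List X) : ∀ x ∈ u, x ∈ g.fn c u := by
  intro x hx
  obtain ⟨s, t, rfl⟩ := List.append_of_mem hx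
  obtain ⟨r, hr⟩ := g.ext' c s x t
  rw [hr]
  simp

end NSub

/-! ### Types of words -/

open Classical in
/-- The list of letters outside `S` in order of first appearance. -/
noncomputable def tp {X : Type} : Set X → List X → List X
  | _, [] => []
  | S, b :: t => if b ∈ S then tp S t else b :: tp (insert b S) t

theorem tp_nil {X : Type} (S : Set X) : tp S [] = [] := rfl
theorem tp_cons_mem {X : Type} {S : Set X} {b : X} (h : b ∈ S) (t : List X) :
    tp S (b :: t) = tp S t := by simp [tp, h]
theorem tp_cons_not_mem {X : Type} {S : Set X} {b : X} (h : b ∉ S) (t : List X) :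
    tp S (b :: t) = b :: tp (insert b S) t := by simp [tp, h]

theorem tp_eq_nil {X : Type} {S : Set X} {u : List X} (h : ∀ x ∈ u, x ∈ S) : tp S u = [] := by
  induction u with
  | nil => rfl
  | cons b t ih =>
    rw [tp_cons_mem (h b (by simp))]
    exact ih fun x hx => h x (by simp [hx])

theorem tp_append {X : Type} (S : Set X) (u t : List X) :
    tp S (u ++ t) = tp S u ++ tp (S ∪ {x | x ∈ u}) t := by
  induction u generalizing S with
  | nil => simp [tp]
  | cons b u ih =>
    by_cases hb : b ∈ S
    · rw [List.cons_append, tp_cons_mem hb, tp_cons_mem hb, ih]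
      congr 2
      ext x
      simp only [Set.mem_union, Set.mem_ofPred_eq, List.mem_cons]
      constructor
      · tauto
      · rintro (h | rfl | h) <;> tauto
    · rw [List.cons_append, tp_cons_not_mem hb, tp_cons_not_mem hb, ih]
      rw [List.cons_append]
      congr 3
      ext x
      simp only [Set.mem_union, Set.mem_ofPred_eq, List.mem_cons, Set.mem_insert_iff]
      tauto

theorem tp_tp {X : Type} (S : Set X) (u : List X) : tp S (tp S u) = tp S u := by
  induction u generalizing S with
  | nil => rfl
  | cons b u ih =>
    by_cases hb : b ∈ S
    · rw [tp_cons_mem hb, ih]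
    · rw [tp_cons_not_mem hb, tp_cons_not_mem hb, ih]

theorem tp_not_mem {X : Type} (S : Set X) (u : List X) : ∀ x ∈ tp S u, x ∉ S := by
  induction u generalizing S with
  | nil => simp [tp]
  | cons b u ih =>
    by_cases hb : b ∈ S
    · rw [tp_cons_mem hb]; exact ih S
    · rw [tp_cons_not_mem hb]
      intro x hx
      rcases List.mem_cons.1 hx with rfl | hx
      · exact hb
      · exact fun h => ih _ x hx (Set.mem_insert_of_mem _ h)

theorem tp_nodup {X : Type} (S : Set X) (u : List X) : (tp S u).Nodup := by
  induction u generalizing S with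
  | nil => simp [tp]
  | cons b u ih =>
    by_cases hb : b ∈ S
    · rw [tp_cons_mem hb]; exact ih S
    · rw [tp_cons_not_mem hb, List.nodup_cons]
      exact ⟨fun h => tp_not_mem _ _ _ h (Set.mem_insert _ _), ih _⟩

theorem tp_fn {C X : Type} (g : NSub C) (c : C → X) (u : List X) :
    tp (Set.range c) (g.fn c u) = tp (Set.range c) u := by
  induction u using List.reverseRecOn with
  | nil =>
    rw [tp_nil, tp_eq_nil]
    intro x hx
    simpa using g.supp c [] x hx
  | append_singleton u b ih =>
    obtain ⟨s, hs⟩ := g.ext c u b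
    have hsupp := g.supp c (u ++ [b])
    rw [hs] at hsupp ⊢
    rw [tp_append, tp_append, ih]
    congr 1
    have hS : Set.range c ∪ {x | x ∈ g.fn c u} = Set.range c ∪ {x | x ∈ u} := by
      ext x
      simp only [Set.mem_union, Set.mem_ofPred_eq]
      have h1 := g.supp c u x
      have h2 := g.mem_fn c u x
      tauto
    rw [hS]
    have hs' : ∀ x ∈ s, x ∈ insert b (Set.range c ∪ {x | x ∈ u}) := by
      intro x hx
      have := hsupp x (by simp [hx])
      simp only [List.mem_append, List.mem_singleton] at this
      simp only [Set.mem_union, Set.mem_ofPred_eq, Set.mem_insert_iff]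
      tauto
    by_cases hb : b ∈ Set.range c ∪ {x | x ∈ u}
    · rw [tp_cons_mem hb, tp_cons_mem hb, tp_nil]
      rw [Set.insert_eq_of_mem hb] at hs'
      exact tp_eq_nil hs'
    · rw [tp_cons_not_mem hb, tp_cons_not_mem hb, tp_nil, tp_eq_nil hs']

/-! ### The zero-dimensional theorem -/

/-- Concatenate the blocks of left variable words. -/
def runw {C X : Type} (y : ℕ → List (Option C)) (c : C → X) : ℕ → List X → List X
  | _, [] => []
  | n, b :: t => b :: ((y n).map (fun o => o.elim b c) ++ runw y c (n + 1) t)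

theorem runw_snoc {C X : Type} (y : ℕ → List (Option C)) (c : C → X) (n : ℕ) (u : List X) (b : X) :
    runw y c n (u ++ [b]) =
      runw y c n u ++ b :: (y (n + u.length)).map (fun o => o.elim b c) := by
  induction u generalizing n with
  | nil => simp [runw]
  | cons d u ih => 
    have : n + 1 + u.length = n + (u.length + 1) := by omega
    simp [runw, ih, this]

/-- The substitution given by a constant word and a sequence of left variable words. -/
def NSub.ofSeq {C : Type} (c₀ : List C) (y : ℕ → List (Option C)) : NSub C where
  fn c u := c₀.map c ++ runw y c 0 u
  nat {X Y} f c u := by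
    rw [List.map_append, List.map_map]
    congr 1
    generalize 0 = n
    induction u generalizing n with
    | nil => rfl
    | cons b u ih =>
      simp only [List.map_cons, runw, List.map_append, List.map_map, ih]
      congr 2
      apply List.map_congr_left
      intro o _
      cases o <;> rfl
  ext c u b := by
    rw [runw_snoc]
    exact ⟨(y (0 + u.length)).map (fun o => o.elim b c), by simp⟩

theorem zero_dim {C K : Type} [Finite C] [Finite K] (χ : List C → K) :
    ∃ (g : NSub C) (k : K), ∀ u : List C, χ (g.fn id u) = k := by
  obtain ⟨k, L, ⟨s₀, hs₀⟩, hLk, hstep⟩ := exists_large (C := C) χ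
  let F : Type := {F : Set (FreeMonoid C) // F.Finite ∧ ∀ s ∈ F, L s}
  choose Y hY using fun F : F => hstep F.1 F.2.1 F.2.2
  let nxt : F → F := fun G => ⟨(fun q : FreeMonoid C × C =>
      q.1 * (FreeMonoid.of q.2 * evw q.2 (Y G))) '' (G.1 ×ˢ Set.univ),
    (G.2.1.prod Set.finite_univ).image _, by
      rintro _ ⟨⟨s, a⟩, ⟨hs, -⟩, rfl⟩
      exact hY G s hs a⟩
  let sq : ℕ → F := fun n => Nat.rec ⟨{s₀}, Set.finite_singleton _, by simpa using hs₀⟩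
    (fun _ G => nxt G) n
  let y : ℕ → List (Option C) := fun n => FreeMonoid.toList (Y (sq n))
  refine ⟨NSub.ofSeq (FreeMonoid.toList s₀) y, k, fun u => ?_⟩
  have key : ∀ u : List C, FreeMonoid.ofList ((NSub.ofSeq (FreeMonoid.toList s₀) y).fn id u) ∈
      (sq u.length).1 := by
    intro u
    induction u using List.reverseRecOn with
    | nil => simp [NSub.ofSeq, runw, sq]
    | append_singleton u b ih =>
      rw [List.length_append, List.length_singleton]
      refine ⟨⟨_, b⟩, ⟨ih, trivial⟩, ?_⟩
      simp only [NSub.ofSeq, runw_snoc, List.map_id, zero_add]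
      rw [← List.append_assoc, FreeMonoid.ofList_append]
      congr 1
      have : (fun o : Option C => o.elim b id) = fun o => o.getD b := by
        funext o; cases o <;> rfl
      rw [this]
      rfl
  exact hLk _ ((sq u.length).2.2 _ (key u))

/-! ### Lifting a constant to a parameter -/

/-- Keep the first `l + 1` letters and use the letter with index `l` as the extra constant
of `g` on the rest of the word. -/
def liftw {C X : Type} (g : NSub (Option C)) (c : C → X) : ℕ → List X → List X
  | _, [] => []
  | 0, d :: t => d :: g.fn (fun o : Option C => o.elim d c) t
  | l + 1, x :: t => x :: liftw g c l t

/-- `liftw` as a substitution. -/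
def NSub.lift {C : Type} (g : NSub (Option C)) (l : ℕ) : NSub C where
  fn c u := liftw g c l u
  nat {X Y} f c u := by
    induction u generalizing l with
    | nil => cases l <;> rfl
    | cons b u ih =>
      cases l with
      | zero =>
        simp only [List.map_cons, liftw]
        rw [← g.nat]
        congr 2
        funext o
        cases o <;> rfl
      | succ l => simp only [List.map_cons, liftw, ih]
  ext {X} c u b := by
    induction u generalizing l with
    | nil =>
      cases l with
      | zero => exact ⟨_, rfl⟩
      | succ l => exact ⟨[], by cases l <;> rfl⟩
    | cons d u ih =>
      cases l with
      | zero =>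
        obtain ⟨s, hs⟩ := g.ext (fun o : Option C => o.elim d c) u b
        exact ⟨s, by simp only [List.cons_append, liftw, hs]⟩
      | succ l =>
        obtain ⟨s, hs⟩ := ih l
        exact ⟨s, by simp only [List.cons_append, liftw, hs]⟩

theorem lift_apply {C X : Type} (g : NSub (Option C)) (c : C → X) (p : List X) (d : X)
    (t : List X) : (g.lift p.length).fn c (p ++ d :: t) =
      p ++ d :: g.fn (fun o : Option C => o.elim d c) t := by
  change liftw g c p.length (p ++ d :: t) = _
  induction p with
  | nil => rfl
  | cons x p ih => simp only [List.length_cons, List.cons_append, liftw, ih]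

/-- The substitution fixes all words of length at most `l`. -/
def NSub.Fixes {C : Type} (g : NSub C) (l : ℕ) : Prop :=
  ∀ (X : Type) (c : C → X) (u : List X), u.length ≤ l → g.fn c u = u

theorem lift_fixes {C : Type} (g : NSub (Option C)) (l : ℕ) : (g.lift l).Fixes l := by
  intro X c u hu
  change liftw g c l u = u
  induction u generalizing l with
  | nil => cases l <;> rfl
  | cons x u ih =>
    cases l with
    | zero => simp at hu
    | succ l =>
      simp only [List.length_cons, add_le_add_iff_right] at hu
      simp only [liftw, ih l hu]

/-! ### Fusion -/

/-- The color of a word extending `u ++ [b]` depends only on its type. -/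
def Good {C X K : Type} (c : C → X) (χ : List X → K) (G : NSub C) (u : List X) (b : X) : Prop :=
  ∀ t t' : List X, tp (Set.range c) (u ++ b :: t) = tp (Set.range c) (u ++ b :: t') →
    χ (G.fn c (u ++ b :: t)) = χ (G.fn c (u ++ b :: t'))

theorem Good.comp {C X K : Type} {c : C → X} {χ : List X → K} {G : NSub C} {u : List X} {b : X}
    (h : Good c χ G u b) {k : NSub C} (hk : k.Fixes u.length) : Good c χ (G.comp k) u b := by
  intro t t' htt
  obtain ⟨s, hs⟩ := k.ext' c u b t
  obtain ⟨s', hs'⟩ := k.ext' c u b t'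
  rw [hk X c u le_rfl] at hs hs'
  change χ (G.fn c (k.fn c _)) = χ (G.fn c (k.fn c _))
  have h1 := tp_fn k c (u ++ b :: t)
  have h2 := tp_fn k c (u ++ b :: t')
  rw [hs] at h1 ⊢
  rw [hs'] at h2 ⊢
  exact h s s' (by rw [h1, h2, htt])

theorem NSub.Fixes.comp {C : Type} {g h : NSub C} {l : ℕ} (hg : g.Fixes l) (hh : h.Fixes l) :
    (g.comp h).Fixes l := by
  intro X c u hu
  change g.fn c (h.fn c u) = u
  rw [hh X c u hu, hg X c u hu]

theorem range_elim {C X : Type} (c : C → X) (b : X) :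
    Set.range (fun o : Option C => o.elim b c) = insert b (Set.range c) := by
  ext x
  simp only [Set.mem_range, Set.mem_insert_iff]
  constructor
  · rintro ⟨o, rfl⟩
    cases o with
    | none => exact Or.inl rfl
    | some a => exact Or.inr ⟨a, rfl⟩
  · rintro (rfl | ⟨a, rfl⟩)
    · exact ⟨none, rfl⟩
    · exact ⟨some a, rfl⟩

/-- The Ramsey statement for a given alphabet and constants. -/
def Ram {C X : Type} (c : C → X) : Prop :=
  ∀ (K : Type) [Finite K] (χ : List X → K), ∃ g : NSub C, ∀ u v,
    tp (Set.range c) u = tp (Set.range c) v → χ (g.fn c u) = χ (g.fn c v)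

theorem good_one {C X K : Type} [Finite K] (c : C → X) (χ : List X → K) (G : NSub C)
    (u : List X) (hu : ∀ x ∈ u, x ∈ Set.range c) (b : X) (hb : b ∉ Set.range c)
    (ih : Ram (fun o : Option C => o.elim b c)) :
    ∃ k : NSub C, k.Fixes u.length ∧ Good c χ (G.comp k) u b := by
  obtain ⟨g, hg⟩ := ih K (fun t => χ (G.fn c (u ++ b :: t)))
  refine ⟨g.lift u.length, lift_fixes _ _, ?_⟩
  intro t t' htt
  change χ (G.fn c ((g.lift u.length).fn c _)) = χ (G.fn c ((g.lift u.length).fn c _))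
  rw [lift_apply, lift_apply]
  apply hg
  have hS : Set.range c ∪ {x | x ∈ u} = Set.range c := by
    ext x
    simp only [Set.mem_union, Set.mem_ofPred_eq]
    have := hu x
    tauto
  rw [tp_append, tp_append, hS, List.append_cancel_left_eq, tp_cons_not_mem hb,
    tp_cons_not_mem hb] at htt
  rw [range_elim]
  exact (List.cons_injective htt)

theorem good_level {C X K : Type} [Finite X] [Finite K] (c : C → X) (χ : List X → K) (G : NSub C)
    (ih : ∀ b, b ∉ Set.range c → Ram (fun o : Option C => o.elim b c)) (l : ℕ) :
    ∃ k : NSub C, k.Fixes l ∧ ∀ u : List X, u.length = l → (∀ x ∈ u, x ∈ Set.range c) →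
      ∀ b, b ∉ Set.range c → Good c χ (G.comp k) u b := by
  have hfin : Set.Finite {q : List X × X | q.1.length = l ∧ (∀ x ∈ q.1, x ∈ Set.range c) ∧
      q.2 ∉ Set.range c} := by
    apply Set.Finite.subset ((List.finite_length_eq X l).prod (Set.finite_univ (α := X)))
    rintro ⟨u, b⟩ ⟨h, -⟩
    exact ⟨h, trivial⟩
  have key : ∀ S : Set (List X × X), S.Finite → S ⊆ {q : List X × X | q.1.length = l ∧
      (∀ x ∈ q.1, x ∈ Set.range c) ∧ q.2 ∉ Set.range c} →
      ∃ k : NSub C, k.Fixes l ∧ ∀ q ∈ S, Good c χ (G.comp k) q.1 q.2 := by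
    intro S hS
    induction S, hS using Set.Finite.induction_on with
    | empty => exact fun _ => ⟨NSub.one C, fun _ _ _ _ => rfl, by simp⟩
    | @insert q S _ _ ihS =>
      intro hsub
      obtain ⟨k, hk, hkS⟩ := ihS ((Set.subset_insert _ _).trans hsub)
      obtain ⟨hl, hu, hb⟩ := hsub (Set.mem_insert _ _)
      obtain ⟨k', hk', hg⟩ := good_one c χ (G.comp k) q.1 hu q.2 hb (ih q.2 hb)
      rw [hl] at hk'
      refine ⟨k.comp k', hk.comp hk', ?_⟩
      rintro q' (rfl | hq')
      · exact hg
      · have hl' := (hsub (Set.mem_insert_of_mem _ hq')).1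
        rw [← hl'] at hk'
        exact (hkS q' hq').comp hk'
  obtain ⟨k, hk, h⟩ := key _ hfin subset_rfl
  exact ⟨k, hk, fun u hu hu' b hb => h (u, b) ⟨hu, hu', hb⟩⟩

theorem fusion {C X K : Type} [Finite X] [Finite K] (c : C → X) (χ : List X → K)
    (ih : ∀ b, b ∉ Set.range c → Ram (fun o : Option C => o.elim b c)) :
    ∃ G : NSub C, ∀ u : List X, (∀ x ∈ u, x ∈ Set.range c) →
      ∀ b, b ∉ Set.range c → Good c χ G u b := by
  choose k hk hgood using fun (G : NSub C) (l : ℕ) => good_level c χ G ih l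
  let sq : ℕ → NSub C := fun n => Nat.rec (NSub.one C) (fun l G => G.comp (k G l)) n
  have hsq : ∀ n, sq (n + 1) = (sq n).comp (k (sq n) n) := fun n => rfl
  have hstab : ∀ {Y : Type} (d : C → Y) (u : List Y) (m : ℕ), u.length ≤ m →
      (sq m).fn d u = (sq u.length).fn d u := by
    intro Y d u m hm
    induction m, hm using Nat.le_induction with
    | base => rfl
    | succ m hm ihm =>
      rw [← ihm, hsq]
      change (sq m).fn d ((k (sq m) m).fn d u) = _
      rw [hk (sq m) m Y d u hm]
  let G : NSub C :=
    { fn := fun d u => (sq u.length).fn d u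
      nat := fun f d u => by rw [List.length_map, (sq u.length).nat]
      ext := fun d u b => by
        obtain ⟨s, hs⟩ := (sq (u ++ [b]).length).ext d u b
        refine ⟨s, ?_⟩
        rw [hs, hstab d u (u ++ [b]).length (by simp)] }
  refine ⟨G, fun u hu b hb => ?_⟩
  have hg : ∀ m, u.length + 1 ≤ m → Good c χ (sq m) u b := by
    intro m hm
    induction m, hm using Nat.le_induction with
    | base => exact hgood _ _ u rfl hu b hb
    | succ m hm ihm =>
      rw [hsq]
      apply ihm.comp
      intro Y d v hv
      exact hk _ _ Y d v (by omega)
  intro t t' htt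
  have h := hg ((u ++ b :: t).length + (u ++ b :: t').length) (by simp; omega) t t' htt
  rw [hstab c (u ++ b :: t) _ (by omega), hstab c (u ++ b :: t') _ (by omega)] at h
  exact h

theorem ram_of {C X : Type} [Finite C] [Finite X] (c : C → X)
    (ih : ∀ b, b ∉ Set.range c → Ram (fun o : Option C => o.elim b c)) : Ram c := by
  classical
  intro K _ χ
  have := Fintype.ofFinite X
  obtain ⟨G, hG⟩ := fusion c χ ih
  obtain ⟨g, κ, hg⟩ := zero_dim (C := C)
    (fun u => fun τ : {τ : List X // τ.Nodup} => χ (G.fn c (u.map c ++ τ.1)))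
  refine ⟨G.comp g, ?_⟩
  have key : ∀ u, χ ((G.comp g).fn c u) = κ ⟨tp (Set.range c) u, tp_nodup _ _⟩ := by
    intro u
    obtain ⟨p, t, hu, hp, ht⟩ : ∃ (p : List C) (t : List X), u = p.map c ++ t ∧
        True ∧ (t = [] ∨ ∃ b s, t = b :: s ∧ b ∉ Set.range c) := by
      induction u with
      | nil => exact ⟨[], [], rfl, trivial, Or.inl rfl⟩
      | cons x u ihu =>
        by_cases hx : x ∈ Set.range c
        · obtain ⟨a, rfl⟩ := hx
          obtain ⟨p, t, rfl, -, ht⟩ := ihu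
          exact ⟨a :: p, t, rfl, trivial, ht⟩
        · exact ⟨[], x :: u, rfl, trivial, Or.inr ⟨x, u, rfl, hx⟩⟩
    have hgp : g.fn c (p.map c) = (g.fn id p).map c := g.nat c id p
    have hmem : ∀ q : List C, ∀ x ∈ q.map c, x ∈ Set.range c := by
      intro q x hx
      obtain ⟨a, -, rfl⟩ := List.mem_map.1 hx
      exact ⟨a, rfl⟩
    have hS : ∀ q : List C, Set.range c ∪ {x | x ∈ q.map c} = Set.range c := by
      intro q
      ext x
      simp only [Set.mem_union, Set.mem_ofPred_eq]
      have := hmem q x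
      tauto
    have htp : ∀ (q : List C) (t : List X),
        tp (Set.range c) (q.map c ++ t) = tp (Set.range c) t := by
      intro q t
      rw [tp_append, hS, tp_eq_nil (hmem q), List.nil_append]
    rw [← hg p]
    change χ (G.fn c (g.fn c u)) = χ (G.fn c ((g.fn id p).map c ++ tp (Set.range c) u))
    rcases ht with rfl | ⟨b, s, rfl, hb⟩
    · have : tp (Set.range c) u = [] := by rw [hu, htp, tp_nil]
      rw [this, hu, List.append_nil, List.append_nil, hgp]
    · obtain ⟨s', hs'⟩ := g.ext' c (p.map c) b s
      have h1 : tp (Set.range c) u = b :: tp (insert b (Set.range c)) s := by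
        rw [hu, htp, tp_cons_not_mem hb]
      have h2 := tp_fn g c u
      rw [hu, hs', hgp, htp, ← hu] at h2
      rw [h1]
      rw [hu, hs', hgp]
      apply hG _ (hmem _) b hb
      rw [htp, htp, h2, ← h1, tp_tp]
  intro u v huv
  rw [key, key]
  congr 2

theorem ram {X : Type} [Finite X] : ∀ (n : ℕ) (C : Type) [Finite C] (c : C → X),
    (Set.range c)ᶜ.ncard = n → Ram c := by
  intro n
  induction n using Nat.strong_induction_on with
  | _ n ih =>
    intro C _ c hn
    apply ram_of
    intro b hb
    refine ih _ ?_ (Option C) _ rfl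
    rw [← hn, range_elim]
    apply Set.ncard_lt_ncard _ (Set.toFinite _)
    refine ⟨Set.compl_subset_compl.2 (Set.subset_insert _ _), fun h => ?_⟩
    exact h hb (Set.mem_insert _ _)

/-! ### The graph -/

/-- The universal graph on binary words. -/
def wrel (u v : List Bool) : Prop := v[u.length]? = some true

theorem wrel_lt {u v : List Bool} (h : wrel u v) : u.length < v.length := by
  unfold wrel at h
  by_contra hlt
  rw [List.getElem?_eq_none (by omega)] at h
  simp at h

theorem wrel_embed {A : Type} (rA : A → A → Prop) (e : A → ℕ) (he : Function.Injective e)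
    (hr : ∀ x y, rA x y → e x < e y) : ∃ f : A → List Bool, OEmb rA wrel f := by
  classical
  let f : A → List Bool := fun x =>
    (List.range (e x)).map fun i => decide (∃ z, e z = i ∧ rA z x)
  have hl : ∀ x, (f x).length = e x := by intro x; simp [f]
  refine ⟨f, ?_, ?_⟩
  · intro x y hxy
    apply he
    rw [← hl, hxy, hl]
  · intro x y
    unfold wrel
    rw [hl]
    constructor
    · intro h
      have := hr x y h
      simp only [f, List.getElem?_map, List.getElem?_range this, Option.map_some,
        Option.some.injEq, decide_eq_true_eq]
      exact ⟨x, rfl, h⟩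
    · intro h
      have hlt : e x < e y := by
        by_contra hlt
        rw [List.getElem?_eq_none (by rw [hl]; omega)] at h
        simp at h
      simp only [f, List.getElem?_map, List.getElem?_range hlt, Option.map_some,
        Option.some.injEq, decide_eq_true_eq] at h
      obtain ⟨z, hz, hzy⟩ := h
      rwa [he hz] at hzy

theorem finite_acyclic_rank {A : Type} [Finite A] (r : A → A → Prop) (h : IsAcyclic r) :
    ∃ e : A → ℕ, Function.Injective e ∧ ∀ x y, r x y → e x < e y := by
  obtain ⟨n, ⟨ε⟩⟩ := Finite.exists_equiv_fin A
  let a : A → ℕ := fun x => {y | Relation.TransGen r y x}.ncard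
  refine ⟨fun x => n * a x + ε x, ?_, ?_⟩
  · intro x y hxy
    have h1 := congrArg (· % n) hxy
    simp only [Nat.mul_add_mod, Nat.mod_eq_of_lt (ε _).2] at h1
    exact ε.injective (Fin.ext h1)
  · intro x y hxy
    have hlt : a x < a y := by
      apply Set.ncard_lt_ncard _ (Set.toFinite _)
      refine ⟨fun z hz => Relation.TransGen.tail hz hxy, fun hsub => ?_⟩
      exact h x (hsub (Relation.TransGen.single hxy))
    have h2 : n * (a x + 1) ≤ n * a y := Nat.mul_le_mul_left n hlt
    have h3 := (ε x).2
    change n * a x + ε x < n * a y + ε y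
    rw [mul_add] at h2
    omega

theorem fn_emb (g : NSub Bool) : OEmb wrel wrel (g.fn id : List Bool → List Bool) := by
  have hmono : ∀ u v : List Bool, u.length < v.length →
      ∃ p b t s, v = p ++ b :: t ∧ p.length = u.length ∧
        g.fn id v = g.fn id p ++ b :: s := by
    intro u v h
    obtain ⟨s, hs⟩ := g.ext' id (v.take u.length) (v[u.length]) (v.drop (u.length + 1))
    have hv : v.take u.length ++ v[u.length] :: v.drop (u.length + 1) = v := by simp
    rw [hv] at hs
    exact ⟨_, _, _, s, hv.symm, by simp; omega, hs⟩
  have hlen : ∀ u v : List Bool, u.length = v.length →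
      (g.fn id u).length = (g.fn id v).length := by
    intro u v h
    have h1 := congrArg List.length (g.nat (fun _ => ()) id u)
    have h2 := congrArg List.length (g.nat (fun _ => ()) id v)
    have : u.map (fun _ => ()) = v.map (fun _ => ()) := by simp [h]
    rw [this] at h1
    rw [List.length_map] at h1 h2
    rw [← h1, ← h2]
  have hlt : ∀ u v : List Bool, u.length < v.length →
      (g.fn id u).length < (g.fn id v).length := by
    intro u v h
    obtain ⟨p, b, t, s, -, hp, hs⟩ := hmono u v h
    rw [hs, ← hlen p u hp]
    simp
  have hle : ∀ u v : List Bool, (g.fn id u).length < (g.fn id v).length →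
      u.length < v.length := by
    intro u v h
    rcases lt_trichotomy u.length v.length with h1 | h1 | h1
    · exact h1
    · have := hlen u v h1; omega
    · have := hlt v u h1; omega
  constructor
  · intro u v huv
    have hl : u.length = v.length := by
      rcases lt_trichotomy u.length v.length with h1 | h1 | h1
      · have := hlt u v h1; rw [huv] at this; omega
      · exact h1
      · have := hlt v u h1; rw [huv] at this; omega
    apply List.ext_getElem hl
    intro i hi hi'
    obtain ⟨p, b, t, s, hu, hp, hs⟩ := hmono (u.take i) u (by simp; omega)
    obtain ⟨p', b', t', s', hv, hp', hs'⟩ := hmono (u.take i) v (by simp; omega)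
    rw [huv, hs'] at hs
    have h1 := List.append_inj_left hs (hlen _ _ (by omega))
    have h2 := List.append_inj_right hs (hlen _ _ (by omega))
    have hb : b' = b := by simpa using (List.cons.inj h2).1
    have hpi : p.length = i := by rw [hp]; simp; omega
    have hpi' : p'.length = i := by rw [hp']; simp; omega
    subst hu hv
    simp [hpi, hpi', hb, List.getElem_append_right]
  · intro u v
    by_cases h : u.length < v.length
    · obtain ⟨p, b, t, s, hv, hp, hs⟩ := hmono u v h
      unfold wrel
      rw [hs, hv, ← hp, ← hlen p u hp]
      simp
    · constructor
      · exact fun h' => absurd (wrel_lt h') h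
      · exact fun h' => absurd (hle _ _ (wrel_lt h')) h

/-! ### Coding tuples by words -/

/-- Read a word up to the first end marker. -/
def rd : List (Option Bool) → List Bool
  | [] => []
  | none :: _ => []
  | some b :: t => b :: rd t

theorem rd_fn {X : Type} (g : NSub Bool) (c : Bool → X) (π : X → Option Bool)
    (hπ : ∀ b, π (c b) = some b) (u : List X) :
    rd ((g.fn c u).map π) = g.fn id (rd (u.map π)) := by
  have hall : ∀ (v : List X) (s : List (Option Bool)), (∀ x ∈ v, (π x).isSome) →
      (s = [] ∨ ∃ s', s = none :: s') →
      rd (v.map π ++ s) = v.map (fun x => (π x).getD true) := by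
    intro v s hv hs
    induction v with
    | nil =>
      rcases hs with rfl | ⟨s', rfl⟩ <;> rfl
    | cons x v ih =>
      obtain ⟨b, hb⟩ := Option.isSome_iff_exists.1 (hv x (by simp))
      simp only [List.map_cons, List.cons_append, hb, rd, Option.getD_some]
      rw [ih fun y hy => hv y (by simp [hy])]
  obtain ⟨p, t, hu, hp, ht⟩ : ∃ p t : List X, u = p ++ t ∧ (∀ x ∈ p, (π x).isSome) ∧
      (t = [] ∨ ∃ b s, t = b :: s ∧ π b = none) := by
    induction u with
    | nil => exact ⟨[], [], rfl, by simp, Or.inl rfl⟩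
    | cons x u ih =>
      cases hx : π x with
      | none => exact ⟨[], x :: u, rfl, by simp, Or.inr ⟨x, u, rfl, hx⟩⟩
      | some b =>
        obtain ⟨p, t, rfl, hp, ht⟩ := ih
        refine ⟨x :: p, t, rfl, ?_, ht⟩
        intro y hy
        rcases List.mem_cons.1 hy with rfl | hy
        · simp [hx]
        · exact hp y hy
  have hgp : ∀ x ∈ g.fn c p, (π x).isSome := by
    intro x hx
    rcases g.supp c p x hx with ⟨b, rfl⟩ | h
    · simp [hπ]
    · exact hp x h
  have hnat := g.nat (fun x => (π x).getD true) c p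
  have hid : (fun x => (π x).getD true) ∘ c = id := by
    funext b; simp [hπ]
  rw [hid] at hnat
  have h1 : rd (u.map π) = p.map (fun x => (π x).getD true) := by
    rw [hu, List.map_append]
    apply hall p _ hp
    rcases ht with rfl | ⟨b, s, rfl, hb⟩
    · exact Or.inl rfl
    · exact Or.inr ⟨s.map π, by simp [hb]⟩
  rw [h1, hnat]
  rcases ht with rfl | ⟨b, s, rfl, hb⟩
  · have := hall (g.fn c p) [] hgp (Or.inl rfl)
    rw [List.append_nil] at this hu
    rw [hu, this]
  · obtain ⟨s', hs'⟩ := g.ext' c p b s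
    rw [hu, hs', List.map_append]
    exact hall _ _ hgp (Or.inr ⟨s'.map π, by simp [hb]⟩)

theorem rd_range (l : List Bool) (N : ℕ) (h : l.length ≤ N) :
    rd ((List.range N).map fun i => l[i]?) = l := by
  induction l generalizing N with
  | nil =>
    cases N with
    | zero => rfl
    | succ N => simp [List.range_succ_eq_map, rd]
  | cons b l ih =>
    cases N with
    | zero => simp at h
    | succ N =>
      simp only [List.length_cons, add_le_add_iff_right] at h
      have := ih N h
      simp only [List.range_succ_eq_map, List.map_cons, List.map_map, List.length_cons,
        List.getElem?_cons_zero, rd]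
      congr 1

theorem big_ramsey {A : Type} [Finite A] (rA : A → A → Prop) :
    ∃ T : ℕ, 0 < T ∧ ∀ k, 2 ≤ k →
      ∀ χ : {f : A → List Bool // OEmb rA wrel f} → Fin k,
        ∃ w : {g : List Bool → List Bool // OEmb wrel wrel g},
          (χ '' {p | ∃ f₀ : {f : A → List Bool // OEmb rA wrel f},
            p.val = w.val ∘ f₀.val}).ncard ≤ T := by
  classical
  have := Fintype.ofFinite A
  let X := A → Option Bool
  have : Fintype X := inferInstance
  have : DecidableEq X := inferInstance
  let c : Bool → X := fun b _ => some b
  have : Fintype {τ : List X // τ.Nodup} := inferInstance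
  refine ⟨Nat.card {τ : List X // τ.Nodup}, ?_, ?_⟩
  · have : Nonempty {τ : List X // τ.Nodup} := ⟨⟨[], List.nodup_nil⟩⟩
    exact Nat.card_pos
  intro k _ χ
  let dec : List X → A → List Bool := fun u a => rd (u.map fun x => x a)
  let χ' : List X → Option (Fin k) := fun u =>
    if h : OEmb rA wrel (dec u) then some (χ ⟨dec u, h⟩) else none
  obtain ⟨g, hg⟩ := ram (X := X) _ Bool c rfl (Option (Fin k)) χ'
  refine ⟨⟨g.fn id, fn_emb g⟩, ?_⟩
  have hsub : some '' (χ '' {p | ∃ f₀ : {f : A → List Bool // OEmb rA wrel f},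
      p.val = (g.fn id) ∘ f₀.val}) ⊆
      Set.range (fun τ : {τ : List X // τ.Nodup} => χ' (g.fn c τ.1)) := by
    rintro _ ⟨_, ⟨p, ⟨f₀, hp⟩, rfl⟩, rfl⟩
    obtain ⟨N, hN⟩ : ∃ N, ∀ a, (f₀.1 a).length ≤ N :=
      ⟨Finset.univ.sup fun a => (f₀.1 a).length, fun a =>
        Finset.le_sup (f := fun a => (f₀.1 a).length) (Finset.mem_univ a)⟩
    let u : List X := (List.range N).map fun i a => (f₀.1 a)[i]?
    have hu : dec u = f₀.1 := by
      funext a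
      simp only [dec, u, List.map_map]
      exact rd_range _ N (hN a)
    have hgu : dec (g.fn c u) = p.1 := by
      rw [hp]
      funext a
      have := rd_fn g c (fun x => x a) (fun b => rfl) u
      simp only [dec, Function.comp]
      rw [this]
      exact congrArg (g.fn id) (congrFun hu a)
    refine ⟨⟨tp (Set.range c) u, tp_nodup _ _⟩, ?_⟩
    have h1 := hg (tp (Set.range c) u) u (tp_tp _ _)
    simp only
    rw [h1]
    have h2 : OEmb rA wrel (dec (g.fn c u)) := by rw [hgu]; exact p.2
    simp only [χ', dif_pos h2]
    congr 2
    exact Subtype.ext hgu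
  calc _ = (some '' (χ '' {p | ∃ f₀ : {f : A → List Bool // OEmb rA wrel f},
      p.val = (g.fn id) ∘ f₀.val})).ncard :=
        (Set.ncard_image_of_injective _ (Option.some_injective _)).symm
    _ ≤ (Set.range (fun τ : {τ : List X // τ.Nodup} => χ' (g.fn c τ.1))).ncard :=
        Set.ncard_le_ncard hsub (Set.toFinite _)
    _ ≤ _ := by
        rw [← Set.image_univ, ← Set.ncard_univ]
        exact Set.ncard_image_le (Set.toFinite _)

theorem stmt10 :
    ∃ (D : Type) (rD : D → D → Prop),
      Countable D ∧ Infinite D ∧ IsOrientedGraph rD ∧ IsAcyclic rD ∧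
      -- (a) universality
      (∀ (A : Type) (rA : A → A → Prop), Finite A → IsOrientedGraph rA →
        IsAcyclic rA → ∃ f : A → D, OEmb rA rD f) ∧
      (∀ (A : Type) (rA : A → A → Prop), Countable A → Infinite A →
        IsOrientedGraph rA → AcyclicOfOrderTypeOmega rA →
        ∃ f : A → D, OEmb rA rD f) ∧
      -- (b) finite big Ramsey degrees
      (∀ (A : Type) (rA : A → A → Prop), Finite A → IsOrientedGraph rA →
        IsAcyclic rA →
        ∃ T : ℕ, 0 < T ∧ ∀ k, 2 ≤ k →
          ∀ χ : {f : A → D // OEmb rA rD f} → Fin k,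
            ∃ w : {g : D → D // OEmb rD rD g},
              (χ '' {p | ∃ f₀ : {f : A → D // OEmb rA rD f},
                p.val = w.val ∘ f₀.val}).ncard ≤ T) := by
  have hlt : ∀ u v : List Bool, Relation.TransGen wrel u v → u.length < v.length := by
    intro u v h
    induction h with
    | single h => exact wrel_lt h
    | tail _ h ih => exact ih.trans (wrel_lt h)
  refine ⟨List Bool, wrel, inferInstance, inferInstance, ⟨?_, ?_⟩, ?_, ?_, ?_, ?_⟩
  · exact fun x h => lt_irrefl _ (wrel_lt h)
  · exact fun x y h h' => lt_asymm (wrel_lt h) (wrel_lt h')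
  · exact fun x h => lt_irrefl _ (hlt x x h)
  · intro A rA _ _ hA
    obtain ⟨e, he, hr⟩ := finite_acyclic_rank rA hA
    exact wrel_embed rA e he hr
  · rintro A rA _ _ _ ⟨e, he⟩
    exact wrel_embed rA e e.injective he
  · intro A rA _ _ _
    exact big_ramsey rA
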